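/- Let (Ω,𝓕,P) be a probability space, Z : Ω → ℝ^T a random vector, and let Y(ω) be given by the model with fixed X, β^{(0)},…,β^{(N)} and change-points η_1 < ⋯ < η_N. Let 𝒮(ω) = {S_1(ω),…,S_{R(ω)}(ω)} be a (measurable) random finite collection of intervals contained in [1,T] such that, for every ω and every interval S ∈ 𝒮(ω), D_S(ω) > λ_α. Then P(∃ i ∈ {1,…,R} such that ∀ j ∈ {1,…,N}, [η_j, η_j+1] ⊄ S_i) ≤ P(‖Z‖_{𝓘^d} > λ_α) ≤ P(‖Z‖_{𝓘^a} > λ_α). -/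

import Mathlib

open Finset MeasureTheory

/-- Scaled partial sum `U_{s,e}(y) = (e-s+1)^{-1/2} ∑_{t=s}^e y_t`. -/
noncomputable def scaledPartialSum (y : ℕ → ℝ) (s e : ℕ) : ℝ :=
  (∑ t ∈ Finset.Icc s e, y t) / Real.sqrt ((e : ℝ) - (s : ℝ) + 1)

/-- Multiresolution sup-norm of `y` over the collection `I` of intervals (given
as pairs of endpoints). -/
noncomputable def mrNorm (y : ℕ → ℝ) (I : Set (ℕ × ℕ)) : ℝ :=
  sSup ((fun q : ℕ × ℕ => |scaledPartialSum y q.1 q.2|) '' I)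

/-- The collection `𝓘^a` of all intervals `[s,e] ⊆ [1,T]`. -/
def allIntervals (T : ℕ) : Set (ℕ × ℕ) :=
  {q | 1 ≤ q.1 ∧ q.1 ≤ q.2 ∧ q.2 ≤ T}

/-- The collection `𝓘^d` of all intervals `[s,e] ⊆ [1,T]` of dyadic lengths
`e - s = 2^j - 1`, `j = 0, …, ⌊log₂ T⌋`. -/
def dyadicIntervals (T : ℕ) : Set (ℕ × ℕ) :=
  {q | 1 ≤ q.1 ∧ q.1 ≤ q.2 ∧ q.2 ≤ T ∧
    ∃ j : ℕ, j ≤ Nat.log 2 T ∧ q.2 - q.1 = 2 ^ j - 1}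

/-- Restriction `𝓘_{[s,e]}` of a collection of intervals to those contained in `[s,e]`. -/
def restrictTo (I : Set (ℕ × ℕ)) (s e : ℕ) : Set (ℕ × ℕ) :=
  {q ∈ I | s ≤ q.1 ∧ q.2 ≤ e}

/-- `D_{[s,e]} = inf_β ‖Y_{s:e} − X_{s:e,·}β‖_{𝓘^d_{[s,e]}}`. -/
noncomputable def Ddev {p : ℕ} (T : ℕ) (X : ℕ → Fin p → ℝ) (Y : ℕ → ℝ) (s e : ℕ) : ℝ :=
  sInf (Set.range fun β : Fin p → ℝ =>
    mrNorm (fun t => Y t - ∑ i, X t i * β i) (restrictTo (dyadicIntervals T) s e))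

lemma mrNorm_nonneg (y : ℕ → ℝ) (I : Set (ℕ × ℕ)) : 0 ≤ mrNorm y I := by
  apply Real.sSup_nonneg
  rintro _ ⟨q, _, rfl⟩
  exact abs_nonneg _

lemma finite_allIntervals (T : ℕ) : (allIntervals T).Finite := by
  refine ((Set.finite_Iic T).prod (Set.finite_Iic T)).subset ?_
  rintro ⟨a, b⟩ ⟨_, h₂, h₃⟩
  exact ⟨le_trans h₂ h₃, h₃⟩

lemma dyadicIntervals_subset_allIntervals (T : ℕ) : dyadicIntervals T ⊆ allIntervals T :=
  fun _ h => ⟨h.1, h.2.1, h.2.2.1⟩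

lemma mrNorm_mono (y : ℕ → ℝ) {I J : Set (ℕ × ℕ)} (hJ : J.Finite) (hIJ : I ⊆ J) :
    mrNorm y I ≤ mrNorm y J := by
  apply Real.sSup_le _ (mrNorm_nonneg y J)
  rintro _ ⟨q, hq, rfl⟩
  exact le_csSup (hJ.image _).bddAbove ⟨q, hIJ hq, rfl⟩

lemma scaledPartialSum_congr {y z : ℕ → ℝ} {s e : ℕ} (h : ∀ t ∈ Finset.Icc s e, y t = z t) :
    scaledPartialSum y s e = scaledPartialSum z s e := by
  rw [scaledPartialSum, scaledPartialSum, Finset.sum_congr rfl h]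

lemma mrNorm_restrictTo_congr {y z : ℕ → ℝ} (I : Set (ℕ × ℕ)) {s e : ℕ}
    (h : ∀ t ∈ Finset.Icc s e, y t = z t) :
    mrNorm y (restrictTo I s e) = mrNorm z (restrictTo I s e) := by
  unfold mrNorm
  congr 1
  refine Set.image_congr fun q hq => ?_
  rw [scaledPartialSum_congr fun t ht => h t (Finset.Icc_subset_Icc hq.2.1 hq.2.2 ht)]

lemma Ddev_le {p : ℕ} (T : ℕ) (X : ℕ → Fin p → ℝ) (Y : ℕ → ℝ) (s e : ℕ) (β : Fin p → ℝ) :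
    Ddev T X Y s e ≤
      mrNorm (fun t => Y t - ∑ i, X t i * β i) (restrictTo (dyadicIntervals T) s e) := by
  refine csInf_le ⟨0, ?_⟩ ⟨β, rfl⟩
  rintro _ ⟨b, rfl⟩
  exact mrNorm_nonneg _ _

/-- On an interval where the linear model holds with a single coefficient vector, the deviation
is at most the dyadic multiresolution norm of the noise. -/
lemma Ddev_le_mrNorm_noise {p : ℕ} (T : ℕ) (X : ℕ → Fin p → ℝ) (Y Z : ℕ → ℝ) {s e : ℕ}
    (β : Fin p → ℝ) (h : ∀ t ∈ Finset.Icc s e, Y t = (∑ i, X t i * β i) + Z t) :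
    Ddev T X Y s e ≤ mrNorm Z (dyadicIntervals T) := by
  refine (Ddev_le T X Y s e β).trans ?_
  rw [mrNorm_restrictTo_congr (z := Z) _ fun t ht => by rw [h t ht]; ring]
  exact mrNorm_mono Z ((finite_allIntervals T).subset (dyadicIntervals_subset_allIntervals T))
    fun _ hq => hq.1

/-- A point above `η 0` and at most `η (N + 1)` lies in a segment `(η j, η (j + 1)]`. -/
lemma exists_lt_and_le_succ {η : ℕ → ℕ} {N s : ℕ} (h₀ : η 0 < s) (h₁ : s ≤ η (N + 1)) :
    ∃ j ≤ N, η j < s ∧ s ≤ η (j + 1) := by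
  induction N with
  | zero => exact ⟨0, le_rfl, h₀, h₁⟩
  | succ n ih =>
    rcases lt_or_ge (η (n + 1)) s with h | h
    · exact ⟨n + 1, le_rfl, h, h₁⟩
    · obtain ⟨j, hj, hs⟩ := ih h
      exact ⟨j, by omega, hs⟩

open ProbabilityTheory in
/-- Theorem 1 of the paper: for a random collection
`𝒮(ω) = {S_1(ω), …, S_{R(ω)}(ω)}` of intervals with `D_{S_i} > λ_α`, the
probability that some `S_i` contains no change-point is bounded by
`P(‖Z‖_{𝓘^d} > λ_α) ≤ P(‖Z‖_{𝓘^a} > λ_α)`. -/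
theorem stmt_2 {Ω : Type*} [MeasurableSpace Ω] (P : Measure Ω) [IsProbabilityMeasure P]
    (T p N : ℕ) (X : ℕ → Fin p → ℝ) (Z : Ω → ℕ → ℝ) (Y : Ω → ℕ → ℝ)
    (η : ℕ → ℕ) (β : ℕ → Fin p → ℝ)
    (hη0 : η 0 = 0) (hηlast : η (N + 1) = T)
    (hmono : ∀ j ≤ N, η j < η (j + 1))
    (hmodel : ∀ ω, ∀ j ≤ N, ∀ t, η j < t → t ≤ η (j + 1) →
      Y ω t = (∑ i, X t i * β j i) + Z ω t)
    (R : Ω → ℕ) (S : Ω → ℕ → ℕ × ℕ) (lam : ℝ)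
    (hS : ∀ ω i, 1 ≤ i → i ≤ R ω →
      1 ≤ (S ω i).1 ∧ (S ω i).1 ≤ (S ω i).2 ∧ (S ω i).2 ≤ T)
    (hD : ∀ ω i, 1 ≤ i → i ≤ R ω →
      Ddev T X (Y ω) (S ω i).1 (S ω i).2 > lam) :
    P {ω | ∃ i, 1 ≤ i ∧ i ≤ R ω ∧ ∀ j, 1 ≤ j → j ≤ N →
        ¬ ((S ω i).1 ≤ η j ∧ η j + 1 ≤ (S ω i).2)}
      ≤ P {ω | mrNorm (Z ω) (dyadicIntervals T) > lam} ∧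
    P {ω | mrNorm (Z ω) (dyadicIntervals T) > lam}
      ≤ P {ω | mrNorm (Z ω) (allIntervals T) > lam} := by
  refine ⟨measure_mono ?_, measure_mono fun ω hω => lt_of_lt_of_le hω
    (mrNorm_mono _ (finite_allIntervals T) (dyadicIntervals_subset_allIntervals T))⟩
  rintro ω ⟨i, hi, hiR, hno⟩
  obtain ⟨h₁, h₂, h₃⟩ := hS ω i hi hiR
  obtain ⟨j, hj, hjs, hsj⟩ := exists_lt_and_le_succ (η := η) (N := N) (s := (S ω i).1)
    (by omega) (by omega)
  have he : (S ω i).2 ≤ η (j + 1) := by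
    rcases hj.eq_or_lt with rfl | hlt
    · omega
    · have := hno (j + 1) (by omega) hlt
      omega
  refine lt_of_lt_of_le (hD ω i hi hiR) (Ddev_le_mrNorm_noise T X (Y ω) (Z ω) (β j) fun t ht => ?_)
  rw [Finset.mem_Icc] at ht
  exact hmodel ω j hj t (by omega) (by omega)
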